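/- arXiv:1402.1589 — 3 statements merged into one kernel-verified Lean document; each statement's English description precedes it below -/
import Mathlib

section
/- Let L be a bounded distributive lattice. Every prime filter of L is an ultrafilter (i.e., Ult L = Pf L) if and only if L is a Boolean algebra, i.e., every element of L has a complement. -/
/-- A filter in a bounded lattice. -/
def IsLatticeFilter {L : Type*} [Lattice L] [BoundedOrder L] (F : Set L) : Prop :=
  ⊥ ∉ F ∧ ⊤ ∈ F ∧ ∀ a ∈ F, ∀ b ∈ F, ∀ x : L, a ⊓ b ≤ x → x ∈ F

/-- An ultrafilter of a bounded lattice: a maximal filter. -/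
def IsUltraLatFilter {L : Type*} [Lattice L] [BoundedOrder L] (F : Set L) : Prop :=
  IsLatticeFilter F ∧ ∀ G : Set L, IsLatticeFilter G → F ⊆ G → G = F

/-- A prime filter of a bounded lattice. -/
def IsPrimeLatFilter {L : Type*} [Lattice L] [BoundedOrder L] (F : Set L) : Prop :=
  IsLatticeFilter F ∧ ∀ a b : L, a ⊔ b ∈ F → a ∈ F ∨ b ∈ F

open Order in
/-- The complement of a prime ideal is a prime filter. -/
theorem Order.Ideal.IsPrime.isPrimeLatFilter_compl {L : Type*} [Lattice L] [BoundedOrder L]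
    {J : Ideal L} (hJ : J.IsPrime) : IsPrimeLatFilter (J : Set L)ᶜ := by
  refine ⟨⟨fun h => h J.bot_mem, hJ.1.top_notMem, fun a ha b hb x hx hxJ => ?_⟩, fun a b h => ?_⟩
  · exact (hJ.mem_or_mem (J.lower hx hxJ)).elim ha hb
  · by_contra! hab
    exact h (Ideal.sup_mem (not_not.mp hab.1) (not_not.mp hab.2))

/-- In a distributive lattice, the filter generated by `a` and all `d` with `a ⊔ d = ⊤`. -/
theorem isPFilter_codisjoint_inf {L : Type*} [DistribLattice L] [BoundedOrder L] (a : L) :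
    Order.IsPFilter {x : L | ∃ d, a ⊔ d = ⊤ ∧ d ⊓ a ≤ x} := by
  refine Order.IsPFilter.of_def ⟨⊤, ⊤, by simp⟩ ?_ ?_
  · rintro x ⟨d, hd, hdx⟩ y ⟨e, he, hey⟩
    refine ⟨x ⊓ y, ⟨d ⊓ e, by rw [sup_inf_left, hd, he, inf_top_eq], le_inf ?_ ?_⟩,
      inf_le_left, inf_le_right⟩
    · exact (inf_le_inf_right a inf_le_left).trans hdx
    · exact (inf_le_inf_right a inf_le_right).trans hey
  · rintro x y hxy ⟨d, hd, hdx⟩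
    exact ⟨d, hd, hdx.trans hxy⟩

open Order in
/-- An element without a complement is separated by two comparable prime ideals. -/
theorem exists_isPrime_le_of_not_isComplemented {L : Type*} [DistribLattice L] [BoundedOrder L]
    {a : L} (ha : ¬ ∃ b, a ⊓ b = ⊥ ∧ a ⊔ b = ⊤) :
    ∃ I J : Ideal L, I.IsPrime ∧ J.IsPrime ∧ I ≤ J ∧ a ∉ I ∧ a ∈ J := by
  have hdisj : Disjoint ((isPFilter_codisjoint_inf a).toPFilter : Set L)
      ((⊥ : Ideal L) : Set L) := by
    rw [Set.disjoint_left]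
    rintro x ⟨d, hd, hdx⟩ hx
    have hx : x = ⊥ := le_bot_iff.mp hx
    exact ha ⟨d, by rw [inf_comm]; exact le_bot_iff.mp (hx ▸ hdx), hd⟩
  obtain ⟨I, hI, -, hFI⟩ := DistribLattice.prime_ideal_of_disjoint_filter_ideal hdisj
  have hgen : ∀ x, ∀ d, a ⊔ d = ⊤ → d ⊓ a ≤ x → x ∉ I := fun x d hd hdx =>
    Set.disjoint_left.mp hFI ⟨d, hd, hdx⟩
  have htop : Disjoint ((PFilter.principal (⊤ : L) : PFilter L) : Set L)
      ((I ⊔ Ideal.principal a : Ideal L) : Set L) := by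
    rw [Set.disjoint_left]
    intro x hx hxI
    have hx : ⊤ ≤ x := hx
    obtain ⟨j, hj, hxj⟩ := (Lattice.mem_ideal_sup_principal a x I).mp hxI
    exact hgen j j (by rw [sup_comm]; exact top_le_iff.mp (hx.trans hxj)) inf_le_left hj
  obtain ⟨J, hJ, hIJ, -⟩ := DistribLattice.prime_ideal_of_disjoint_filter_ideal htop
  exact ⟨I, J, hI, hJ, le_sup_left.trans hIJ, hgen a ⊤ (by simp) inf_le_right,
    (le_sup_right.trans hIJ : Ideal.principal a ≤ J) (Ideal.mem_principal_self)⟩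

/-- In a bounded distributive lattice, every prime filter is an ultrafilter if and only
if the lattice is a Boolean algebra, i.e. every element has a complement. -/
theorem every_prime_ultra_iff_boolean (L : Type*) [DistribLattice L] [BoundedOrder L] :
    (∀ F : Set L, IsPrimeLatFilter F → IsUltraLatFilter F) ↔
      ∀ a : L, ∃ b : L, a ⊓ b = ⊥ ∧ a ⊔ b = ⊤ := by
  constructor
  · intro h a
    by_contra ha
    obtain ⟨I, J, hI, hJ, hIJ, haI, haJ⟩ := exists_isPrime_le_of_not_isComplemented ha
    have heq := (h _ hJ.isPrimeLatFilter_compl).2 _ hI.isPrimeLatFilter_compl.1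
      (Set.compl_subset_compl.mpr hIJ)
    have haJ' : a ∈ (J : Set L)ᶜ := heq ▸ haI
    exact haJ' haJ
  · intro h F hF
    refine ⟨hF.1, fun G hG hFG => (Set.Subset.antisymm hFG fun x hx => ?_).symm⟩
    obtain ⟨y, hinf, hsup⟩ := h x
    refine (hF.2 x y (hsup ▸ hF.1.2.1)).resolve_right fun hy => hG.1 ?_
    exact hG.2.2 x hx y (hFG hy) ⊥ hinf.le
end

section
/- Let K and L be normal separative bounded distributive lattices and let h : K → L be a bounded lattice homomorphism, with induced map Ult h : Ult L → Ult K. The following are equivalent: (a) h is separative, i.e., for all a ∈ K and b ∈ L with h(a) ⊓ b = ⊥ there exists c ∈ K with a ⊓ c = ⊥ and b ≤ h(c); (b) h⁻¹(p) is an ultrafilter of K for every ultrafilter p of L; (c) (Ult h)⁻¹(a⁺) = h(a)⁺ for every a ∈ K, where a⁺ = {q ∈ Ult K : a ∈ q} and h(a)⁺ = {p ∈ Ult L : h(a) ∈ p}. -/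
/-- A bounded distributive lattice is normal if disjoint elements can be "separated". -/
def IsNormalLat (L : Type*) [Lattice L] [BoundedOrder L] : Prop :=
  ∀ a b : L, a ⊓ b = ⊥ → ∃ a₁ b₁ : L, a₁ ⊓ b = ⊥ ∧ a ⊓ b₁ = ⊥ ∧ a₁ ⊔ b₁ = ⊤

/-- A bounded lattice is separative if whenever `⊥ < a` and `a ≰ b` there is
`c` with `⊥ < c ≤ a` and `c ⊓ b = ⊥`. -/
def IsSeparativeLat (L : Type*) [Lattice L] [BoundedOrder L] : Prop :=
  ∀ a b : L, ⊥ < a → ¬a ≤ b → ∃ c : L, ⊥ < c ∧ c ≤ a ∧ c ⊓ b = ⊥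

/-- `Ult L`: the set of ultrafilters of `L`. -/
abbrev UltraFilterSpace (L : Type*) [Lattice L] [BoundedOrder L] :=
  {F : Set L // IsUltraLatFilter F}

theorem IsLatticeFilter.mem_of_le {L : Type*} [Lattice L] [BoundedOrder L] {F : Set L}
    (hF : IsLatticeFilter F) {a b : L} (ha : a ∈ F) (hab : a ≤ b) : b ∈ F :=
  hF.2.2 a ha a ha b (by simpa using hab)

theorem IsLatticeFilter.inf_mem {L : Type*} [Lattice L] [BoundedOrder L] {F : Set L}
    (hF : IsLatticeFilter F) {a b : L} (ha : a ∈ F) (hb : b ∈ F) : a ⊓ b ∈ F :=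
  hF.2.2 a ha b hb _ le_rfl

theorem IsLatticeFilter.exists_ultra_superset {L : Type*} [Lattice L] [BoundedOrder L]
    {F : Set L} (hF : IsLatticeFilter F) : ∃ G : Set L, IsUltraLatFilter G ∧ F ⊆ G := by
  obtain ⟨G, hFG, hG⟩ := zorn_subset_nonempty {G : Set L | IsLatticeFilter G} (by
    intro C hC hchain hne
    refine ⟨⋃₀ C, ⟨?_, ?_, ?_⟩, fun s hs => Set.subset_sUnion_of_mem hs⟩
    · rintro ⟨s, hs, hbot⟩
      exact (hC hs).1 hbot
    · obtain ⟨s, hs⟩ := hne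
      exact ⟨s, hs, (hC hs).2.1⟩
    · rintro a ⟨s, hs, has⟩ b ⟨t, ht, hbt⟩ x hx
      rcases hchain.total hs ht with hst | hts
      · exact ⟨t, ht, (hC ht).2.2 a (hst has) b hbt x hx⟩
      · exact ⟨s, hs, (hC hs).2.2 a has b (hts hbt) x hx⟩) F hF
  exact ⟨G, ⟨hG.prop, fun H hH hGH => (hG.eq_of_subset hH hGH).symm⟩, hFG⟩

/-- An element meeting every member of an ultrafilter belongs to it. -/
theorem IsUltraLatFilter.exists_inf_eq_bot {L : Type*} [Lattice L] [BoundedOrder L]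
    {F : Set L} (hF : IsUltraLatFilter F) {a : L} (ha : a ∉ F) : ∃ b ∈ F, a ⊓ b = ⊥ := by
  by_contra! hne
  have hG : IsLatticeFilter {x : L | ∃ b ∈ F, a ⊓ b ≤ x} := by
    refine ⟨?_, ⟨⊤, hF.1.2.1, le_top⟩, ?_⟩
    · rintro ⟨b, hb, hbot⟩
      exact hne b hb (le_bot_iff.mp hbot)
    · rintro x ⟨b, hb, hbx⟩ y ⟨c, hc, hcy⟩ z hz
      refine ⟨b ⊓ c, hF.1.inf_mem hb hc, le_trans (le_inf ?_ ?_) hz⟩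
      · exact (inf_le_inf_left a inf_le_left).trans hbx
      · exact (inf_le_inf_left a inf_le_right).trans hcy
  have hGF := hF.2 _ hG fun x hx => ⟨x, hx, inf_le_right⟩
  exact ha (hGF ▸ (⟨⊤, hF.1.2.1, inf_le_left⟩ : a ∈ {x : L | ∃ b ∈ F, a ⊓ b ≤ x}))

theorem IsLatticeFilter.preimage {K L : Type*} [Lattice K] [BoundedOrder K]
    [Lattice L] [BoundedOrder L] (h : BoundedLatticeHom K L) {F : Set L}
    (hF : IsLatticeFilter F) : IsLatticeFilter (⇑h ⁻¹' F) := by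
  refine ⟨?_, ?_, ?_⟩
  · simpa using hF.1
  · simpa using hF.2.1
  · intro a ha b hb x hx
    refine hF.2.2 (h a) ha (h b) hb (h x) ?_
    rw [← map_inf]
    exact OrderHomClass.mono h hx

theorem isUltraLatFilter_preimage_of_separative {K L : Type*} [Lattice K] [BoundedOrder K]
    [Lattice L] [BoundedOrder L] (h : BoundedLatticeHom K L)
    (hsep : ∀ a : K, ∀ b : L, h a ⊓ b = ⊥ → ∃ c : K, a ⊓ c = ⊥ ∧ b ≤ h c)
    {F : Set L} (hF : IsUltraLatFilter F) : IsUltraLatFilter (⇑h ⁻¹' F) := by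
  refine ⟨hF.1.preimage h, fun G hG hFG => Set.Subset.antisymm (fun a ha => ?_) hFG⟩
  by_contra hna
  obtain ⟨b, hb, hab⟩ := hF.exists_inf_eq_bot hna
  obtain ⟨c, hac, hbc⟩ := hsep a b hab
  exact hG.1 (hac ▸ hG.inf_mem ha (hFG (hF.1.mem_of_le hb hbc)))

theorem separative_of_isUltraLatFilter_preimage {K L : Type*} [DistribLattice K]
    [BoundedOrder K] [DistribLattice L] [BoundedOrder L] (hK : IsNormalLat K)
    (h : BoundedLatticeHom K L)
    (hult : ∀ p : UltraFilterSpace L, IsUltraLatFilter (⇑h ⁻¹' p.1))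
    (a : K) (b : L) (hab : h a ⊓ b = ⊥) : ∃ c : K, a ⊓ c = ⊥ ∧ b ≤ h c := by
  by_contra! hne
  have hF : IsLatticeFilter
      {x : L | ∃ d c : K, a ⊓ c = ⊥ ∧ d ⊔ c = ⊤ ∧ b ⊓ h d ≤ x} := by
    refine ⟨?_, ⟨⊤, ⊥, by simp, by simp, le_top⟩, ?_⟩
    · rintro ⟨d, c, hac, hdc, hbd⟩
      refine hne c hac ?_
      calc b = b ⊓ h (d ⊔ c) := by simp [hdc]
        _ = b ⊓ h d ⊔ b ⊓ h c := by rw [map_sup, inf_sup_left]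
        _ ≤ h c := sup_le (hbd.trans bot_le) inf_le_right
    · rintro x ⟨d, c, hac, hdc, hx⟩ y ⟨d', c', hac', hdc', hy⟩ z hz
      refine ⟨d ⊓ d', c ⊔ c', by rw [inf_sup_left, hac, hac', sup_idem], ?_, ?_⟩
      · rw [sup_inf_right, ← sup_assoc, hdc, top_sup_eq, top_inf_eq, sup_left_comm, hdc',
          sup_top_eq]
      · rw [map_inf]
        refine le_trans (le_inf ?_ ?_) hz
        · exact (inf_le_inf_left b inf_le_left).trans hx
        · exact (inf_le_inf_left b inf_le_right).trans hy
  obtain ⟨p, hp, hFp⟩ := hF.exists_ultra_superset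
  have hb : b ∈ p := hFp ⟨⊤, ⊥, by simp, by simp, inf_le_left⟩
  have ha : a ∉ ⇑h ⁻¹' p := fun ha => hp.1.1 (hab ▸ hp.1.inf_mem ha hb)
  obtain ⟨c, hc, hac⟩ := (hult ⟨p, hp⟩).exists_inf_eq_bot ha
  obtain ⟨d, c', hdc, hac', hdc'⟩ := hK a c hac
  have hd : d ∈ ⇑h ⁻¹' p := hFp ⟨d, c', hac', hdc', inf_le_right⟩
  exact (hp.1.preimage h).1 (hdc ▸ (hp.1.preimage h).inf_mem hd hc)

/-- For a bounded lattice homomorphism `h : K → L` between normal separative bounded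
distributive lattices, with induced map `f = Ult h : Ult L → Ult K` (the map sending
`p` to the unique ultrafilter extending `h⁻¹(p)`), the following are equivalent:
(a) `h` is separative; (b) `h⁻¹(p)` is an ultrafilter for every ultrafilter `p` of `L`;
(c) `f⁻¹(a⁺) = h(a)⁺` for every `a ∈ K`. -/
theorem separative_hom_tfae {K L : Type*}
    [DistribLattice K] [BoundedOrder K] [DistribLattice L] [BoundedOrder L]
    (hKn : IsNormalLat K) (hLn : IsNormalLat L)
    (hKs : IsSeparativeLat K) (hLs : IsSeparativeLat L)
    (h : BoundedLatticeHom K L)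
    (f : UltraFilterSpace L → UltraFilterSpace K)
    (hf : ∀ p : UltraFilterSpace L, ⇑h ⁻¹' p.1 ⊆ (f p).1) :
    ((∀ a : K, ∀ b : L, h a ⊓ b = ⊥ → ∃ c : K, a ⊓ c = ⊥ ∧ b ≤ h c) ↔
        ∀ p : UltraFilterSpace L, IsUltraLatFilter (⇑h ⁻¹' p.1)) ∧
    ((∀ p : UltraFilterSpace L, IsUltraLatFilter (⇑h ⁻¹' p.1)) ↔
        ∀ a : K, f ⁻¹' {q : UltraFilterSpace K | a ∈ q.1} =
          {p : UltraFilterSpace L | h a ∈ p.1}) := by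
  refine ⟨⟨fun hsep p => isUltraLatFilter_preimage_of_separative h hsep p.2,
    separative_of_isUltraLatFilter_preimage hKn h⟩, fun hult a => ?_, fun heq p => ?_⟩
  · ext p
    have hfp := (hult p).2 _ (f p).2.1 (hf p)
    change a ∈ (f p).1 ↔ a ∈ ⇑h ⁻¹' p.1
    rw [hfp]
  · have hfp : (f p).1 = ⇑h ⁻¹' p.1 := Set.ext fun a => Set.ext_iff.mp (heq a) p
    exact hfp ▸ (f p).2
end

section
/- Let X be an infinite compact Hausdorff space admitting a T₀-separating family 𝒰 of open Fσ subsets which is σ-point-finite (this is Rosenthal's characterization of Eberlein compactness). Then there exist a zero-dimensional compact Hausdorff space Y with the same weight as X, a σ-point-finite T₀-separating family of clopen subsets of Y, and a continuous surjection from Y onto X. -/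
universe u

/-- The weight of a topological space: the least cardinality of an open base. -/
noncomputable def tweight (X : Type*) [TopologicalSpace X] : Cardinal :=
  ⨅ B : {B : Set (Set X) // TopologicalSpace.IsTopologicalBasis B}, Cardinal.mk B.1

/-- A family of subsets is `T₀`-separating if any two distinct points are separated:
some member contains exactly one of them. -/
def T0Separating {X : Type*} (U : Set (Set X)) : Prop :=
  ∀ x y : X, x ≠ y → ∃ u ∈ U, Xor' (x ∈ u) (y ∈ u)

/-- A family of subsets is point-finite if every point belongs to only finitely many
of its members. -/
def PointFinite {X : Type*} (U : Set (Set X)) : Prop :=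
  ∀ x : X, {u | u ∈ U ∧ x ∈ u}.Finite

/-- A family is σ-point-finite if it is a countable union of point-finite families. -/
def SigmaPointFinite {X : Type*} (U : Set (Set X)) : Prop :=
  ∃ u : ℕ → Set (Set X), U = ⋃ n, u n ∧ ∀ n, PointFinite (u n)

/-- An open `Fσ` set: an open set which is a countable union of closed sets. -/
def IsOpenFSigma {X : Type*} [TopologicalSpace X] (s : Set X) : Prop :=
  IsOpen s ∧ ∃ c : ℕ → Set X, (∀ n, IsClosed (c n)) ∧ s = ⋃ n, c n

open Set TopologicalSpace Cardinal Topology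

theorem tweight_le {X : Type*} [TopologicalSpace X] {B : Set (Set X)}
    (hB : IsTopologicalBasis B) : tweight X ≤ #B :=
  ciInf_le' (fun B : {B : Set (Set X) // IsTopologicalBasis B} => #B.1) ⟨B, hB⟩

theorem exists_isTopologicalBasis_mk_eq_tweight (X : Type*) [TopologicalSpace X] :
    ∃ B : Set (Set X), IsTopologicalBasis B ∧ #B = tweight X := by
  have : Nonempty {B : Set (Set X) // IsTopologicalBasis B} :=
    ⟨⟨_, isTopologicalBasis_opens⟩⟩
  obtain ⟨B, hB⟩ := ciInf_mem (fun B : {B : Set (Set X) // IsTopologicalBasis B} => #B.1)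
  exact ⟨B.1, B.2, hB⟩

theorem TopologicalSpace.IsTopologicalBasis.infinite {X : Type*} [TopologicalSpace X]
    [T0Space X] [Infinite X] {B : Set (Set X)} (hB : IsTopologicalBasis B) : Infinite B := by
  by_contra h
  rw [not_infinite_iff_finite] at h
  have hinj : Function.Injective (fun x : X => {b : B | x ∈ b.1}) := by
    intro x y hxy
    refine hB.eq_iff.2 fun s hs => ?_
    exact Set.ext_iff.1 hxy ⟨s, hs⟩
  exact not_finite_iff_infinite.2 ‹Infinite X› (Finite.of_injective _ hinj)

theorem aleph0_le_tweight (X : Type*) [TopologicalSpace X] [T0Space X] [Infinite X] :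
    ℵ₀ ≤ tweight X := by
  obtain ⟨B, hB, hBX⟩ := exists_isTopologicalBasis_mk_eq_tweight X
  have := hB.infinite
  exact hBX ▸ aleph0_le_mk B

/-- A continuous surjection from a compact space onto a Hausdorff space does not raise weight. -/
theorem tweight_le_of_surjective {X Y : Type u} [TopologicalSpace X] [TopologicalSpace Y]
    [CompactSpace Y] [T2Space X] [T0Space Y] [Infinite Y] {f : Y → X} (hf : Continuous f)
    (hsurj : Function.Surjective f) : tweight X ≤ tweight Y := by
  obtain ⟨B, hB, hBY⟩ := exists_isTopologicalBasis_mk_eq_tweight Y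
  have := hB.infinite
  let g : Finset B → Set X := fun s => (f '' (⋃ b ∈ s, b.1)ᶜ)ᶜ
  have hg : IsTopologicalBasis (range g) := by
    refine isTopologicalBasis_of_isOpen_of_nhds ?_ ?_
    · rintro _ ⟨s, rfl⟩
      have ho : IsOpen (⋃ b ∈ s, b.1) := isOpen_biUnion fun b _ => hB.isOpen b.2
      exact (hf.isClosedMap _ ho.isClosed_compl).isOpen_compl
    · intro x V hx hV
      have hK : IsCompact (f ⁻¹' {x}) := (isClosed_singleton.preimage hf).isCompact
      obtain ⟨s, hs⟩ := hK.elim_finite_subcover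
        (fun b : {b : B // b.1 ⊆ f ⁻¹' V} => b.1.1) (fun b => hB.isOpen b.1.2) (by
          intro y hy
          obtain ⟨b, hb, hyb, hbV⟩ := hB.exists_subset_of_mem_open
            (show y ∈ f ⁻¹' V by rw [mem_preimage, show f y = x from hy]; exact hx)
            (hV.preimage hf)
          exact mem_iUnion.2 ⟨⟨⟨b, hb⟩, hbV⟩, hyb⟩)
      classical
      refine ⟨_, ⟨s.image Subtype.val, rfl⟩, ?_, ?_⟩
      · rintro ⟨y, hy, hyx⟩
        obtain ⟨b, hb, hyb⟩ := mem_iUnion₂.1 (hs hyx)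
        exact hy (mem_iUnion₂.2 ⟨b.1, Finset.mem_image_of_mem _ hb, hyb⟩)
      · intro z hz
        obtain ⟨y, rfl⟩ := hsurj z
        by_contra hyV
        refine hz ⟨y, fun hy => ?_, rfl⟩
        obtain ⟨b, hb, hyb⟩ := mem_iUnion₂.1 hy
        obtain ⟨b', -, rfl⟩ := Finset.mem_image.1 hb
        exact hyV (b'.2 hyb)
  calc tweight X ≤ #(range g) := tweight_le hg
    _ ≤ #(Finset B) := mk_range_le
    _ = tweight Y := by rw [mk_finset_of_infinite, hBY]

/-- A `T₀`-separating family of clopen sets in a compact space bounds its weight. -/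
theorem tweight_le_of_t0Separating {Y : Type u} [tY : TopologicalSpace Y] [CompactSpace Y]
    {W : Set (Set Y)} (hW : ∀ w ∈ W, IsClopen w) (hsep : T0Separating W) {κ : Cardinal.{u}}
    (hκ : ℵ₀ ≤ κ) (hWκ : #W ≤ κ) : tweight Y ≤ κ := by
  let S : Set (Set Y) := W ∪ compl '' W
  have hle : tY ≤ generateFrom S := by
    refine le_generateFrom ?_
    rintro s (hs | ⟨s, hs, rfl⟩)
    · exact (hW s hs).isOpen
    · exact (hW s hs).compl.isOpen
  have hT2 : @T2Space Y (generateFrom S) := by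
    refine @T2Space.mk Y (generateFrom S) fun x y hxy => ?_
    obtain ⟨w, hw, h⟩ := hsep x y hxy
    have h₁ : IsOpen[generateFrom S] w := isOpen_generateFrom_of_mem (Or.inl hw)
    have h₂ : IsOpen[generateFrom S] wᶜ := isOpen_generateFrom_of_mem (Or.inr ⟨w, hw, rfl⟩)
    rcases h with ⟨hx, hy⟩ | ⟨hy, hx⟩
    · exact ⟨w, wᶜ, h₁, h₂, hx, hy, disjoint_compl_right⟩
    · exact ⟨wᶜ, w, h₂, h₁, hx, hy, disjoint_compl_left⟩
  have heq : tY = generateFrom S := by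
    obtain ⟨⟨⟨h⟩, -⟩, -⟩ := @Continuous.isClosedEmbedding Y Y tY (generateFrom S) _ hT2 id
      (continuous_id_iff_le.2 hle) Function.injective_id
    exact h.trans (@induced_id Y (generateFrom S))
  have hS : #S ≤ κ :=
    (mk_union_le _ _).trans (add_le_of_le hκ hWκ (mk_image_le.trans hWκ))
  have hfin : #{f : Set (Set Y) | f.Finite ∧ f ⊆ S} ≤ κ := by
    have hsub : {f : Set (Set Y) | f.Finite ∧ f ⊆ S} ⊆
        range fun s : Finset S => (Subtype.val '' (s : Set S) : Set (Set Y)) := by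
      rintro f ⟨hf, hfS⟩
      have hf' : (Subtype.val ⁻¹' f : Set S).Finite := hf.preimage Subtype.val_injective.injOn
      refine ⟨hf'.toFinset, ?_⟩
      simpa using hfS
    refine (mk_le_mk_of_subset hsub).trans (mk_range_le.trans ?_)
    cases finite_or_infinite S
    · exact (Cardinal.mk_le_aleph0).trans hκ
    · rwa [mk_finset_of_infinite]
  exact (tweight_le (isTopologicalBasis_of_subbasis heq)).trans (mk_image_le.trans hfin)

/-- A σ-point-finite family of open sets is no larger than the weight. -/
theorem SigmaPointFinite.mk_le_tweight {X : Type u} [TopologicalSpace X] [T0Space X] [Infinite X]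
    {U : Set (Set X)} (hU : SigmaPointFinite U) (hopen : ∀ u ∈ U, IsOpen u) :
    #U ≤ tweight X := by
  obtain ⟨B, hB, hBX⟩ := exists_isTopologicalBasis_mk_eq_tweight X
  obtain ⟨V, rfl, hV⟩ := hU
  have hω := aleph0_le_tweight X
  have hp : ∀ b : B, ∃ x : X, b.1.Nonempty → x ∈ b.1 := fun b => by
    by_cases h : b.1.Nonempty
    · exact ⟨h.some, fun _ => h.some_mem⟩
    · exact ⟨Classical.arbitrary X, fun h' => absurd h' h⟩
  choose p hp using hp
  have hsub : (⋃ n, V n) ⊆ {∅} ∪ ⋃ b : B, ⋃ n, {u | u ∈ V n ∧ p b ∈ u} := by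
    intro u hu
    obtain rfl | ⟨x, hx⟩ := u.eq_empty_or_nonempty
    · exact Or.inl rfl
    obtain ⟨b, hb, hxb, hbu⟩ := hB.exists_subset_of_mem_open hx (hopen u hu)
    obtain ⟨n, hn⟩ := mem_iUnion.1 hu
    exact Or.inr (mem_iUnion.2 ⟨⟨b, hb⟩, mem_iUnion.2 ⟨n, hn, hbu (hp ⟨b, hb⟩ ⟨x, hxb⟩)⟩⟩)
  refine (mk_le_mk_of_subset hsub).trans ((mk_union_le _ _).trans (add_le_of_le hω ?_ ?_))
  · rw [mk_singleton]
    exact one_le_aleph0.trans hω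
  · refine (mk_iUnion_le _).trans ?_
    rw [hBX]
    refine mul_le_of_le hω le_rfl (ciSup_le' fun b => le_trans ?_ hω)
    exact le_aleph0_iff_set_countable.2 (countable_iUnion fun n => (hV n (p b)).countable)

theorem IsOpenFSigma.exists_isOpen_closure_subset {X : Type*} [TopologicalSpace X] [NormalSpace X]
    {u : Set X} (hu : IsOpenFSigma u) :
    ∃ V : ℕ → Set X, (∀ n, IsOpen (V n) ∧ closure (V n) ⊆ u) ∧ u = ⋃ n, V n := by
  obtain ⟨ho, c, hc, rfl⟩ := hu
  choose V hV using fun n => normal_exists_closure_subset (hc n) ho (subset_iUnion c n)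
  refine ⟨V, fun n => ⟨(hV n).1, (hV n).2.2⟩, Subset.antisymm ?_ ?_⟩
  · exact iUnion_mono fun n => (hV n).2.1
  · exact iUnion_subset fun n => subset_closure.trans (hV n).2.2

/-- The subspace of `X × 2^I` of all `(x, c)` such that `x` lies in `closure (V i)` when `c i` is
true and outside `V i` when `c i` is false. -/
def codingSpace {X I : Type*} [TopologicalSpace X] (V : I → Set X) : Set (X × (I → Bool)) :=
  {p | ∀ i, (p.2 i = true → p.1 ∈ closure (V i)) ∧ (p.2 i = false → p.1 ∉ V i)}

theorem isClosed_codingSpace {X I : Type*} [TopologicalSpace X] {V : I → Set X}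
    (hV : ∀ i, IsOpen (V i)) : IsClosed (codingSpace V) := by
  have hclopen : ∀ i b, IsClopen {p : X × (I → Bool) | p.2 i = b} := fun i b =>
    (isClopen_discrete {b}).preimage ((continuous_apply i).comp continuous_snd)
  simp only [codingSpace, ofPred_forall, ofPred_and]
  refine isClosed_iInter fun i => IsClosed.inter ?_ ?_
  · exact isClosed_imp (hclopen i true).isOpen (isClosed_closure.preimage continuous_fst)
  · exact isClosed_imp (hclopen i false).isOpen ((hV i).isClosed_compl.preimage continuous_fst)

theorem codingSpace_fst_surjective {X I : Type*} [TopologicalSpace X] (V : I → Set X) :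
    Function.Surjective fun p : codingSpace V => p.1.1 := by
  classical
  intro x
  refine ⟨⟨(x, fun i => decide (x ∈ V i)), fun i => ⟨fun h => ?_, fun h => ?_⟩⟩, rfl⟩
  · exact subset_closure (of_decide_eq_true h)
  · exact of_decide_eq_false h

/-- Every (infinite) Eberlein compact space—i.e. a compact Hausdorff space with a
σ-point-finite `T₀`-separating family of open `Fσ` sets (Rosenthal's
characterization)—is a continuous image of a zero-dimensional Eberlein compact space
of the same weight, where zero-dimensional Eberlein compactness is witnessed by a
σ-point-finite `T₀`-separating family of clopen sets. -/
theorem eberlein_zero_dimensional_preimage (X : Type u) [TopologicalSpace X]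
    [CompactSpace X] [T2Space X] [Infinite X]
    (U : Set (Set X)) (hUopen : ∀ u ∈ U, IsOpenFSigma u)
    (hUsep : T0Separating U) (hUpf : SigmaPointFinite U) :
    ∃ (Y : Type u) (tY : TopologicalSpace Y),
      @CompactSpace Y tY ∧ @T2Space Y tY ∧
      @TopologicalSpace.IsTopologicalBasis Y tY {s : Set Y | @IsClopen Y tY s} ∧
      @tweight Y tY = tweight X ∧
      (∃ W : Set (Set Y), (∀ w ∈ W, @IsClopen Y tY w) ∧
        T0Separating W ∧ SigmaPointFinite W) ∧
      ∃ f : Y → X, @Continuous Y X tY _ f ∧ Function.Surjective f := by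
  have hwit := fun u : U => (hUopen u u.2).exists_isOpen_closure_subset
  choose V hV hVU using hwit
  let G : U × ℕ → Set X := fun i => V i.1 i.2
  let Y := codingSpace G
  let w : U × ℕ → Set Y := fun i => {p | p.1.2 i = true}
  have hw : ∀ i, IsClopen (w i) := fun i =>
    (isClopen_discrete {true}).preimage
      ((continuous_apply i).comp (continuous_snd.comp continuous_subtype_val))
  have hmem : ∀ (i : U × ℕ) (p : Y), p ∈ w i → p.1.1 ∈ i.1.1 := fun i p hp =>
    (hV i.1 i.2).2 ((p.2 i).1 hp)
  have hnotMem : ∀ (u : U) (p : Y), (∀ n, p ∉ w (u, n)) → p.1.1 ∉ u.1 := by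
    intro u p hp hu
    rw [hVU u] at hu
    obtain ⟨n, hn⟩ := mem_iUnion.1 hu
    exact (p.2 (u, n)).2 (Bool.eq_false_iff.2 (hp n)) hn
  have hiff : ∀ (u : U) (p : Y), p.1.1 ∈ u.1 ↔ ∃ n, p ∈ w (u, n) := by
    intro u p
    refine ⟨fun h => ?_, fun ⟨n, hn⟩ => hmem _ _ hn⟩
    by_contra! hn
    exact hnotMem u p hn h
  have hinj : Function.Injective fun p : Y => p.1.2 := by
    intro p q (hpq : p.1.2 = q.1.2)
    refine Subtype.ext (Prod.ext ?_ hpq)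
    by_contra hne
    obtain ⟨u, hu, h⟩ := hUsep _ _ hne
    have h' : p.1.1 ∈ u ↔ q.1.1 ∈ u := by
      rw [hiff ⟨u, hu⟩ p, hiff ⟨u, hu⟩ q]
      simp only [w, mem_ofPred_eq, hpq]
    rcases h with ⟨h₁, h₂⟩ | ⟨h₁, h₂⟩
    · exact h₂ (h'.1 h₁)
    · exact h₂ (h'.2 h₁)
  have hsep : T0Separating (range w) := by
    intro p q hpq
    obtain ⟨i, hi⟩ := Function.ne_iff.1 (hinj.ne hpq)
    refine ⟨w i, mem_range_self i, ?_⟩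
    by_cases h : p.1.2 i = true
    · exact Or.inl ⟨h, fun h' => hi (h.trans (Eq.symm h'))⟩
    · refine Or.inr ⟨by_contra fun h' => hi ?_, h⟩
      exact (Bool.eq_false_iff.2 h).trans (Bool.eq_false_iff.2 h').symm
  have hpf : SigmaPointFinite (range w) := by
    obtain ⟨F, hF, hFpf⟩ := hUpf
    refine ⟨fun k => {s | ∃ u : U, u.1 ∈ F k.unpair.1 ∧ w (u, k.unpair.2) = s}, ?_, ?_⟩
    · ext s
      simp only [mem_range, mem_iUnion, mem_ofPred_eq]
      constructor
      · rintro ⟨⟨u, n⟩, rfl⟩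
        obtain ⟨m, hm⟩ := mem_iUnion.1 (hF ▸ u.2 : u.1 ∈ ⋃ n, F n)
        exact ⟨Nat.pair m n, u, by simpa using hm, by simp⟩
      · rintro ⟨k, u, -, rfl⟩
        exact ⟨_, rfl⟩
    · intro k p
      have hfin := (hFpf k.unpair.1 p.1.1).preimage
        (f := (Subtype.val : U → Set X)) Subtype.val_injective.injOn
      refine (hfin.image fun u => w (u, k.unpair.2)).subset ?_
      rintro s ⟨⟨u, hu, rfl⟩, hp⟩
      exact ⟨u, ⟨hu, hmem _ _ hp⟩, rfl⟩
  have hclopen : ∀ s ∈ range w, IsClopen s := by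
    rintro _ ⟨i, rfl⟩
    exact hw i
  have hsurj : Function.Surjective fun p : Y => p.1.1 := codingSpace_fst_surjective G
  have hcont : Continuous fun p : Y => p.1.1 := continuous_fst.comp continuous_subtype_val
  have : CompactSpace Y :=
    isCompact_iff_compactSpace.1 (isClosed_codingSpace (V := G) fun i => (hV i.1 i.2).1).isCompact
  have : Infinite Y := Infinite.of_surjective _ hsurj
  have : TotallyDisconnectedSpace Y := ⟨isTotallyDisconnected_of_image
    (continuous_snd.comp continuous_subtype_val).continuousOn hinj
    (isTotallyDisconnected_of_totallyDisconnectedSpace _)⟩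
  have hω := aleph0_le_tweight X
  have hcard : #(range w) ≤ tweight X := by
    refine mk_range_le.trans ?_
    rw [mk_prod, mk_nat, lift_aleph0, lift_uzero]
    exact mul_le_of_le hω (hUpf.mk_le_tweight fun u hu => (hUopen u hu).1) hω
  exact ⟨Y, inferInstance, inferInstance, inferInstance, isTopologicalBasis_isClopen,
    (tweight_le_of_t0Separating hclopen hsep hω hcard).antisymm
      (tweight_le_of_surjective hcont hsurj),
    ⟨range w, hclopen, hsep, hpf⟩, _, hcont, hsurj⟩
end
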